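/- arXiv:1906.08906 — 8 statements merged into one kernel-verified Lean document; each statement's English description precedes it below -/
import Mathlib

section
/- For all integers n ≥ 1 and r ≥ 1, in the polynomial ring (ZMod 5)[Y], the polynomial Y^(5^n + 5^(n−1) − 1) divides (4Y+1)^(4r·5^n) − (4Y+1)^(2r·5^n) − 3·(r : ZMod 5)·Y^(5^n). -/
open Polynomial

theorem sq_dvd_one_add_pow_sub {R : Type*} [CommRing R] (z : R) (m : ℕ) :
    z ^ 2 ∣ (z + 1) ^ m - (1 + m * z) := by
  obtain ⟨k, hk⟩ := Polynomial.powAddExpansion 1 z m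
  exact ⟨k, by rw [add_comm z, hk]; simp; ring⟩

/-- Lemma 4.8: for `n ≥ 1`, `r ≥ 1`, in `(ZMod 5)[Y]`,
`Y^(5^n + 5^(n-1) - 1)` divides
`(4Y+1)^(4r·5^n) - (4Y+1)^(2r·5^n) - 3·r·Y^(5^n)`. -/
theorem stmt_2 (n r : ℕ) (hn : 1 ≤ n) (hr : 1 ≤ r) :
    (X : Polynomial (ZMod 5)) ^ (5 ^ n + 5 ^ (n - 1) - 1) ∣
      (4 * X + 1) ^ (4 * r * 5 ^ n) - (4 * X + 1) ^ (2 * r * 5 ^ n)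
        - 3 * C (r : ZMod 5) * X ^ (5 ^ n) := by
  have : Fact (Nat.Prime 5) := ⟨by norm_num⟩
  have hfive : (5 : (ZMod 5)[X]) = 0 := by exact_mod_cast CharP.cast_eq_zero (ZMod 5)[X] 5
  have hfrob : (4 * X + 1 : (ZMod 5)[X]) ^ 5 ^ n = -X ^ 5 ^ n + 1 := by
    rw [show (4 * X + 1 : (ZMod 5)[X]) = 1 - X by linear_combination X * hfive,
      sub_pow_char_pow, one_pow]
    ring
  have hle : 5 ^ n + 5 ^ (n - 1) - 1 ≤ 5 ^ n * 2 := by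
    have := Nat.pow_le_pow_right (n := 5) (by norm_num) (Nat.sub_le n 1)
    omega
  refine (pow_dvd_pow X hle).trans ?_
  rw [mul_comm (4 * r), mul_comm (2 * r), pow_mul X, pow_mul (4 * X + 1),
    pow_mul (4 * X + 1), hfrob]
  set Z : (ZMod 5)[X] := X ^ 5 ^ n
  have key := dvd_sub (sq_dvd_one_add_pow_sub (-Z) (4 * r)) (sq_dvd_one_add_pow_sub (-Z) (2 * r))
  rw [neg_sq] at key
  convert key using 1
  push_cast [map_natCast]
  linear_combination -r * Z * hfive
end

section
/- For all integers n ≥ 2 and r ≥ 1, in the polynomial ring (ZMod 5)[Y], the polynomial Y^(5^n + 5^(n−1) − 1) divides 4·(r : ZMod 5)·Y^(24·5^(n−2))·((4Y+1)^((100r−16)·5^(n−2)) − (4Y+1)^((50r−8)·5^(n−2))) − (r : ZMod 5)·(2·Y^(5^n) + 4·Y^(27·5^(n−2)) + 4·Y^(28·5^(n−2)) + 3·Y^(29·5^(n−2))). -/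
open Polynomial

theorem four_mul_add_one_pow_mul_five_pow (m k : ℕ) :
    (4 * X + 1 : Polynomial (ZMod 5)) ^ (m * 5 ^ k) = (1 - X ^ 5 ^ k) ^ m := by
  have : Fact (Nat.Prime 5) := ⟨by norm_num⟩
  have h5 : (5 : Polynomial (ZMod 5)) = 0 := CharP.cast_eq_zero (Polynomial (ZMod 5)) 5
  have h : (4 * X + 1 : Polynomial (ZMod 5)) = 1 - X := by linear_combination X * h5
  rw [h, mul_comm, pow_mul, sub_pow_char_pow, one_pow]

theorem exists_one_sub_pow_twentyFive_mul {R : Type*} [CommRing R] [CharP R 5] (Z : R) (k : ℕ) :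
    ∃ s, (1 - Z) ^ (25 * k) = 1 + Z ^ 6 * s := by
  have : Fact (Nat.Prime 5) := ⟨by norm_num⟩
  have h : (1 - Z) ^ 25 = 1 - Z ^ 25 := by
    have := sub_pow_char_pow (p := 5) (n := 2) (1 : R) Z
    norm_num at this
    exact this
  obtain ⟨s, hs⟩ := sub_dvd_pow_sub_pow (1 - Z ^ 25) 1 k
  refine ⟨-Z ^ 19 * s, ?_⟩
  rw [one_pow] at hs
  rw [pow_mul, h]
  linear_combination hs

theorem pow_six_dvd_four_mul_one_sub_pow_sub {R : Type*} [CommRing R] [CharP R 5] (Z : R)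
    (a b : ℕ) :
    Z ^ 6 ∣ 4 * ((1 - Z) ^ (9 + 25 * a) - (1 - Z) ^ (17 + 25 * b))
      - (2 * Z + 4 * Z ^ 3 + 4 * Z ^ 4 + 3 * Z ^ 5) := by
  have h5 : (5 : R) = 0 := CharP.cast_eq_zero R 5
  obtain ⟨s, hs⟩ := exists_one_sub_pow_twentyFive_mul Z a
  obtain ⟨t, ht⟩ := exists_one_sub_pow_twentyFive_mul Z b
  rw [pow_add, pow_add, hs, ht]
  refine ⟨4 * ((1 - Z) ^ 9 * s - (1 - Z) ^ 17 * t) + (-49168 + 77648 * Z - 97204 * Z ^ 2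
    + 97236 * Z ^ 3 - 77792 * Z ^ 4 + 49504 * Z ^ 5 - 24752 * Z ^ 6 + 9520 * Z ^ 7
    - 2720 * Z ^ 8 + 544 * Z ^ 9 - 68 * Z ^ 10 + 4 * Z ^ 11), ?_⟩
  linear_combination (6 * Z - 80 * Z ^ 2 + 476 * Z ^ 3 - 1804 * Z ^ 4 + 4849 * Z ^ 5) * h5

/-- Lemma 4.9, first part: for `n ≥ 2`, `r ≥ 1`, in `(ZMod 5)[Y]`,
`Y^(5^n + 5^(n-1) - 1)` divides
`4·r·Y^(24·5^(n-2))·((4Y+1)^((100r-16)·5^(n-2)) - (4Y+1)^((50r-8)·5^(n-2)))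
  - r·(2·Y^(5^n) + 4·Y^(27·5^(n-2)) + 4·Y^(28·5^(n-2)) + 3·Y^(29·5^(n-2)))`. -/
theorem stmt_3 (n r : ℕ) (hn : 2 ≤ n) (hr : 1 ≤ r) :
    (X : Polynomial (ZMod 5)) ^ (5 ^ n + 5 ^ (n - 1) - 1) ∣
      4 * C (r : ZMod 5) * X ^ (24 * 5 ^ (n - 2)) *
          ((4 * X + 1) ^ ((100 * r - 16) * 5 ^ (n - 2))
            - (4 * X + 1) ^ ((50 * r - 8) * 5 ^ (n - 2)))
        - C (r : ZMod 5) * (2 * X ^ (5 ^ n) + 4 * X ^ (27 * 5 ^ (n - 2))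
            + 4 * X ^ (28 * 5 ^ (n - 2)) + 3 * X ^ (29 * 5 ^ (n - 2))) := by
  obtain ⟨k, rfl⟩ := Nat.exists_eq_add_of_le' hn
  obtain ⟨r, rfl⟩ := Nat.exists_eq_add_of_le' hr
  have hA : 100 * (r + 1) - 16 = 9 + 25 * (4 * r + 3) := by omega
  have hB : 50 * (r + 1) - 8 = 17 + 25 * (2 * r + 1) := by omega
  have h5n : 5 ^ (k + 2) = 25 * 5 ^ k := by ring
  have h5n' : 5 ^ (k + 2 - 1) = 5 * 5 ^ k := by
    rw [show k + 2 - 1 = k + 1 by omega]; ring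
  obtain ⟨g, hg⟩ := pow_six_dvd_four_mul_one_sub_pow_sub
    (X ^ 5 ^ k : Polynomial (ZMod 5)) (4 * r + 3) (2 * r + 1)
  rw [Nat.add_sub_cancel, h5n', h5n, hA, hB, four_mul_add_one_pow_mul_five_pow,
    four_mul_add_one_pow_mul_five_pow]
  have hle : 25 * 5 ^ k + 5 * 5 ^ k - 1 ≤ 5 ^ k * 30 := by omega
  refine (pow_dvd_pow X hle).trans ⟨C ((r + 1 : ℕ) : ZMod 5) * g, ?_⟩
  simp only [mul_comm _ (5 ^ k), pow_mul X (5 ^ k)]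
  linear_combination C ((r + 1 : ℕ) : ZMod 5) * (X ^ 5 ^ k) ^ 24 * hg
end

section
/- For all integers n ≥ 2 and r ≥ 1, in the polynomial ring (ZMod 5)[Y], the polynomial Y^(5^n + 5^(n−1) − 1) divides 3·(r : ZMod 5)·Y^(27·5^(n−2))·((4Y+1)^((100r−18)·5^(n−2)) + (4Y+1)^((50r−9)·5^(n−2))) − (r : ZMod 5)·(Y^(27·5^(n−2)) + Y^(28·5^(n−2)) + 3·Y^(29·5^(n−2))). -/
open Polynomial

/-- In characteristic `5`, a power of `4X + 1` depends, modulo `X ^ 5`, only on the exponent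
modulo `5`. -/
lemma X_pow_five_dvd_pow_five_mul_add_sub_pow (k j : ℕ) :
    (X : Polynomial (ZMod 5)) ^ 5 ∣ (4 * X + 1) ^ (5 * k + j) - (4 * X + 1) ^ j := by
  have : Fact (Nat.Prime 5) := ⟨Nat.prime_five⟩
  have h : (X : Polynomial (ZMod 5)) ^ 5 ∣ (4 * X + 1) ^ 5 - 1 :=
    ⟨4 ^ 5, by rw [add_pow_char]; ring⟩
  have hk : (4 * X + 1 : Polynomial (ZMod 5)) ^ 5 - 1 ∣ ((4 * X + 1) ^ 5) ^ k - 1 := by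
    simpa using sub_dvd_pow_sub_pow ((4 * X + 1 : Polynomial (ZMod 5)) ^ 5) 1 k
  rw [pow_add, pow_mul, ← sub_one_mul]
  exact (h.trans hk).mul_right _

lemma X_pow_three_dvd_three_mul_pow_add_pow_sub (k m : ℕ) :
    (X : Polynomial (ZMod 5)) ^ 3 ∣
      3 * ((4 * X + 1) ^ (5 * k + 2) + (4 * X + 1) ^ (5 * m + 1)) - (1 + X + 3 * X ^ 2) := by
  have h5 : (5 : Polynomial (ZMod 5)) = 0 := CharP.cast_eq_zero (Polynomial (ZMod 5)) 5
  obtain ⟨u, hu⟩ := X_pow_five_dvd_pow_five_mul_add_sub_pow k 2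
  obtain ⟨v, hv⟩ := X_pow_five_dvd_pow_five_mul_add_sub_pow m 1
  refine ⟨3 * X ^ 2 * (u + v), ?_⟩
  linear_combination 3 * hu + 3 * hv + (1 + 7 * X + 9 * X ^ 2) * h5

/-- Lemma 4.9, second part: for `n ≥ 2`, `r ≥ 1`, in `(ZMod 5)[Y]`,
`Y^(5^n + 5^(n-1) - 1)` divides
`3·r·Y^(27·5^(n-2))·((4Y+1)^((100r-18)·5^(n-2)) + (4Y+1)^((50r-9)·5^(n-2)))
  - r·(Y^(27·5^(n-2)) + Y^(28·5^(n-2)) + 3·Y^(29·5^(n-2)))`. -/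
theorem stmt_4 (n r : ℕ) (hn : 2 ≤ n) (hr : 1 ≤ r) :
    (X : Polynomial (ZMod 5)) ^ (5 ^ n + 5 ^ (n - 1) - 1) ∣
      3 * C (r : ZMod 5) * X ^ (27 * 5 ^ (n - 2)) *
          ((4 * X + 1) ^ ((100 * r - 18) * 5 ^ (n - 2))
            + (4 * X + 1) ^ ((50 * r - 9) * 5 ^ (n - 2)))
        - C (r : ZMod 5) * (X ^ (27 * 5 ^ (n - 2)) + X ^ (28 * 5 ^ (n - 2))
            + 3 * X ^ (29 * 5 ^ (n - 2))) := by
  have : Fact (Nat.Prime 5) := ⟨Nat.prime_five⟩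
  obtain ⟨s, rfl⟩ := Nat.exists_eq_add_of_le' hn
  obtain ⟨t, rfl⟩ := Nat.exists_eq_add_of_le' hr
  obtain ⟨w, hw⟩ := X_pow_three_dvd_three_mul_pow_add_pow_sub (20 * t + 16) (10 * t + 8)
  rw [Nat.add_sub_cancel, show 100 * (t + 1) - 18 = 5 * (20 * t + 16) + 2 by lia,
    show 50 * (t + 1) - 9 = 5 * (10 * t + 8) + 1 by lia]
  generalize 5 * (20 * t + 16) + 2 = a at hw ⊢
  generalize 5 * (10 * t + 8) + 1 = b at hw ⊢
  have h3 : (3 : Polynomial (ZMod 5)) ^ 5 ^ s = 3 := by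
    rw [← C_ofNat, ← C_pow, ZMod.pow_card_pow]
  have hq := congrArg (· ^ 5 ^ s) hw
  simp only [sub_pow_char_pow, add_pow_char_pow, mul_pow, h3, one_pow] at hq
  have hle : 5 ^ (s + 2) + 5 ^ (s + 2 - 1) - 1 ≤ 30 * 5 ^ s := by
    rw [show s + 2 - 1 = s + 1 by lia, pow_add, pow_succ]
    lia
  refine (pow_dvd_pow X hle).trans ⟨C ((t + 1 : ℕ) : ZMod 5) * w ^ 5 ^ s, ?_⟩
  rw [pow_mul _ a, pow_mul _ b]
  linear_combination C ((t + 1 : ℕ) : ZMod 5) * X ^ (27 * 5 ^ s) * hq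
end

section
/- For all integers n ≥ 3 and r ≥ 1, in the polynomial ring (ZMod 5)[Y], the polynomial Y^(5^n + 5^(n−1) − 1) divides (r : ZMod 5)·Y^(6·5^(n−1) − 3)·((4Y+1)^((20r−4)·5^(n−1) + 2) + (4Y+1)^((10r−2)·5^(n−1) + 1)) − (r : ZMod 5)·(2·Y^(6·5^(n−1) − 3) + 2·Y^(6·5^(n−1) − 2)). -/
open Polynomial

/-- Modulo `X ^ 2`, every fifth power of `4 * X + 1` is `1` in characteristic five. -/
lemma X_sq_dvd_linear_pow_sub_one (N : ℕ) (hN : 5 ∣ N) :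
    (X : Polynomial (ZMod 5)) ^ 2 ∣ (4 * X + 1) ^ N - 1 := by
  obtain ⟨k, rfl⟩ := hN
  have h5 : (5 : Polynomial (ZMod 5)) = 0 := CharP.cast_eq_zero (Polynomial (ZMod 5)) 5
  have h : (X : Polynomial (ZMod 5)) ^ 2 ∣ (4 * X + 1) ^ 5 - 1 := by
    refine ⟨1024 * X ^ 3 + 1280 * X ^ 2 + 640 * X + 160, ?_⟩
    linear_combination 4 * X * h5
  rw [pow_mul]
  exact h.trans (sub_one_dvd_pow_sub_one _ k)

/-- Modulo `X ^ 2`, the sum of two powers of `4 * X + 1` with exponents congruent to `2` and `1`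
modulo five is `2 + 2 * X` in characteristic five. -/
lemma X_sq_dvd_linear_pow_add_pow (N M : ℕ) (hN : 5 ∣ N) (hM : 5 ∣ M) :
    (X : Polynomial (ZMod 5)) ^ 2 ∣
      (4 * X + 1) ^ (N + 2) + (4 * X + 1) ^ (M + 1) - (2 + 2 * X) := by
  have h5 : (5 : Polynomial (ZMod 5)) = 0 := CharP.cast_eq_zero (Polynomial (ZMod 5)) 5
  obtain ⟨a, ha⟩ := X_sq_dvd_linear_pow_sub_one N hN
  obtain ⟨b, hb⟩ := X_sq_dvd_linear_pow_sub_one M hM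
  refine ⟨(4 * X + 1) ^ 2 * a + (4 * X + 1) * b + 16, ?_⟩
  linear_combination (4 * X + 1) ^ 2 * ha + (4 * X + 1) * hb + 2 * X * h5

/-- Lemma 4.9, third part: for `n ≥ 3`, `r ≥ 1`, in `(ZMod 5)[Y]`,
`Y^(5^n + 5^(n-1) - 1)` divides
`r·Y^(6·5^(n-1)-3)·((4Y+1)^((20r-4)·5^(n-1)+2) + (4Y+1)^((10r-2)·5^(n-1)+1))
  - r·(2·Y^(6·5^(n-1)-3) + 2·Y^(6·5^(n-1)-2))`. -/
theorem stmt_5 (n r : ℕ) (hn : 3 ≤ n) (hr : 1 ≤ r) :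
    (X : Polynomial (ZMod 5)) ^ (5 ^ n + 5 ^ (n - 1) - 1) ∣
      C (r : ZMod 5) * X ^ (6 * 5 ^ (n - 1) - 3) *
          ((4 * X + 1) ^ ((20 * r - 4) * 5 ^ (n - 1) + 2)
            + (4 * X + 1) ^ ((10 * r - 2) * 5 ^ (n - 1) + 1))
        - C (r : ZMod 5) * (2 * X ^ (6 * 5 ^ (n - 1) - 3)
            + 2 * X ^ (6 * 5 ^ (n - 1) - 2)) := by
  have hq : 5 ∣ 5 ^ (n - 1) := dvd_pow_self 5 (by omega)
  have hpos : 0 < 5 ^ (n - 1) := by positivity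
  have hn' : 5 ^ n = 5 * 5 ^ (n - 1) := by
    rw [← pow_succ', Nat.sub_add_cancel (by omega)]
  have hexp : 5 ^ n + 5 ^ (n - 1) - 1 = (6 * 5 ^ (n - 1) - 3) + 2 := by omega
  have hexp' : 6 * 5 ^ (n - 1) - 2 = (6 * 5 ^ (n - 1) - 3) + 1 := by omega
  obtain ⟨c, hc⟩ := X_sq_dvd_linear_pow_add_pow ((20 * r - 4) * 5 ^ (n - 1))
    ((10 * r - 2) * 5 ^ (n - 1)) (hq.mul_left _) (hq.mul_left _)
  rw [hexp, hexp']
  refine ⟨C (r : ZMod 5) * c, ?_⟩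
  linear_combination C (r : ZMod 5) * X ^ (6 * 5 ^ (n - 1) - 3) * hc
end

section
/- For all integers n ≥ 3, r ≥ 1, and m with 1 ≤ m ≤ n−2, in the polynomial ring (ZMod 5)[Y], the polynomial Y^(5^n + 5^(n−1) − 1) divides 3·(r : ZMod 5)·Y^(6·5^(n−1) − 6·5^(n−m−2))·((4Y+1)^(16·5^(n−1) + 4·5^(n−m−2) + 4(r−1)·5^n) − (4Y+1)^(8·5^(n−1) + 2·5^(n−m−2) + 2(r−1)·5^n)) − (r : ZMod 5)·(4·Y^(6·5^(n−1) − 5^(n−m−1)) + 3·Y^(6·5^(n−1) − 3·5^(n−m−2)) + 3·Y^(6·5^(n−1) − 2·5^(n−m−2))). -/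
open Polynomial

theorem four_mul_X_add_one_pow_five_pow (k : ℕ) :
    (4 * X + 1 : (ZMod 5)[X]) ^ 5 ^ k = 1 - X ^ 5 ^ k := by
  have : Fact (Nat.Prime 5) := ⟨by norm_num⟩
  have h5 : (5 : (ZMod 5)[X]) = 0 := CharP.cast_eq_zero (ZMod 5)[X] 5
  have h : (4 * X + 1 : (ZMod 5)[X]) = 1 - X := by linear_combination X * h5
  rw [h, sub_pow_char_pow, one_pow]

theorem dvd_one_sub_pow_sub_one {R : Type*} [CommRing R] (w : R) (a : ℕ) :
    w ∣ (1 - w) ^ a - 1 := by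
  have h := sub_dvd_pow_sub_pow (1 - w) 1 a
  rw [one_pow] at h
  exact (Dvd.intro (-1) (by ring)).trans h

/-- Lemma 4.10, first part: for `n ≥ 3`, `r ≥ 1`, `1 ≤ m ≤ n-2`, in `(ZMod 5)[Y]`,
`Y^(5^n + 5^(n-1) - 1)` divides
`3·r·Y^(6·5^(n-1)-6·5^(n-m-2))·((4Y+1)^(16·5^(n-1)+4·5^(n-m-2)+4(r-1)·5^n)
    - (4Y+1)^(8·5^(n-1)+2·5^(n-m-2)+2(r-1)·5^n))
  - r·(4·Y^(6·5^(n-1)-5^(n-m-1)) + 3·Y^(6·5^(n-1)-3·5^(n-m-2)) + 3·Y^(6·5^(n-1)-2·5^(n-m-2)))`. -/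
theorem stmt_6 (n r m : ℕ) (hn : 3 ≤ n) (hr : 1 ≤ r) (hm1 : 1 ≤ m) (hm2 : m ≤ n - 2) :
    (X : Polynomial (ZMod 5)) ^ (5 ^ n + 5 ^ (n - 1) - 1) ∣
      3 * C (r : ZMod 5) * X ^ (6 * 5 ^ (n - 1) - 6 * 5 ^ (n - m - 2)) *
          ((4 * X + 1) ^ (16 * 5 ^ (n - 1) + 4 * 5 ^ (n - m - 2) + 4 * (r - 1) * 5 ^ n)
            - (4 * X + 1) ^ (8 * 5 ^ (n - 1) + 2 * 5 ^ (n - m - 2) + 2 * (r - 1) * 5 ^ n))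
        - C (r : ZMod 5) * (4 * X ^ (6 * 5 ^ (n - 1) - 5 ^ (n - m - 1))
            + 3 * X ^ (6 * 5 ^ (n - 1) - 3 * 5 ^ (n - m - 2))
            + 3 * X ^ (6 * 5 ^ (n - 1) - 2 * 5 ^ (n - m - 2))) := by
  have h5 : (5 : (ZMod 5)[X]) = 0 := CharP.cast_eq_zero (ZMod 5)[X] 5
  have hq1 : 5 ^ (n - m - 1) = 5 * 5 ^ (n - m - 2) := by
    rw [← pow_succ']; congr 1; omega
  have hQ : 5 ^ n = 5 * 5 ^ (n - 1) := by
    rw [← pow_succ']; congr 1; omega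
  have hle : 25 * 5 ^ (n - m - 2) ≤ 5 ^ (n - 1) := by
    rw [show 25 = 5 ^ 2 from rfl, ← pow_add]
    exact Nat.pow_le_pow_right (by norm_num) (by omega)
  have hTq := four_mul_X_add_one_pow_five_pow (n - m - 2)
  have hTQ := four_mul_X_add_one_pow_five_pow (n - 1)
  rw [hq1, hQ]
  generalize 5 ^ (n - m - 2) = q at *
  generalize 5 ^ (n - 1) = Q at *
  have hpow (a b : ℕ) : (4 * X + 1 : (ZMod 5)[X]) ^ (Q * a + q * b)
      = (1 - X ^ Q) ^ a * (1 - X ^ q) ^ b := by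
    rw [pow_add, pow_mul, pow_mul, hTq, hTQ]
  rw [show 16 * Q + 4 * q + 4 * (r - 1) * (5 * Q) = Q * (16 + 20 * (r - 1)) + q * 4 by ring,
    show 8 * Q + 2 * q + 2 * (r - 1) * (5 * Q) = Q * (8 + 10 * (r - 1)) + q * 2 by ring,
    hpow, hpow,
    show 6 * Q - 5 * q = (6 * Q - 6 * q) + q by omega,
    show 6 * Q - 3 * q = (6 * Q - 6 * q) + q * 3 by omega,
    show 6 * Q - 2 * q = (6 * Q - 6 * q) + q * 4 by omega]
  obtain ⟨u, hu⟩ := dvd_one_sub_pow_sub_one (X ^ Q : (ZMod 5)[X]) (16 + 20 * (r - 1))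
  obtain ⟨v, hv⟩ := dvd_one_sub_pow_sub_one (X ^ Q : (ZMod 5)[X]) (8 + 10 * (r - 1))
  refine (pow_dvd_pow X (show 5 * Q + Q - 1 ≤ (6 * Q - 6 * q) + Q by omega)).trans ?_
  rw [sub_eq_iff_eq_add.mp hu, sub_eq_iff_eq_add.mp hv]
  simp only [pow_add, pow_mul]
  generalize (X ^ (6 * Q - 6 * q) : (ZMod 5)[X]) = D
  generalize (X ^ q : (ZMod 5)[X]) = Z
  generalize (X ^ Q : (ZMod 5)[X]) = W
  refine ⟨3 * C (r : ZMod 5) * (u * (1 - Z) ^ 4 - v * (1 - Z) ^ 2), ?_⟩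
  linear_combination C (r : ZMod 5) * D * (-2 * Z + 3 * Z ^ 2 - 3 * Z ^ 3) * h5
end

section
/- Fix integers n ≥ 2 and r ≥ 1, and in the polynomial ring (ZMod 5)[Y] define LΔ = (4Y+1)^(4r·5^n) − (4Y+1)^(2r·5^n); LC₀ = 4·(r : ZMod 5)·Y^(24·5^(n−2))·((4Y+1)^((100r−16)·5^(n−2)) − (4Y+1)^((50r−8)·5^(n−2))); LD₀ = 3·(r : ZMod 5)·Y^(27·5^(n−2))·((4Y+1)^((100r−18)·5^(n−2)) + (4Y+1)^((50r−9)·5^(n−2))); and for 1 ≤ m ≤ n−2, LC_m = 3·(r : ZMod 5)·Y^(6·5^(n−1)−6·5^(n−m−2))·((4Y+1)^(16·5^(n−1)+4·5^(n−m−2)+4(r−1)·5^n) − (4Y+1)^(8·5^(n−1)+2·5^(n−m−2)+2(r−1)·5^n)) and LD_m = (r : ZMod 5)·Y^(6·5^(n−1)−3·5^(n−m−2))·((4Y+1)^(16·5^(n−1)+2·5^(n−m−2)+4(r−1)·5^n) + (4Y+1)^(8·5^(n−1)+5^(n−m−2)+2(r−1)·5^n)). Then for every integer u with 1 ≤ u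 ≤ n−1, the polynomial Y^(5^n + 5^(n−1) − 5^(n−u−1)) divides LΔ + Σ_{m=0}^{u−1} (LC_m + LD_m). -/
open Polynomial Finset

/-- `LΔ = (4Y+1)^(4r·5^n) - (4Y+1)^(2r·5^n)` in `(ZMod 5)[Y]`. -/
noncomputable def Ldelta (n r : ℕ) : Polynomial (ZMod 5) :=
  (4 * X + 1) ^ (4 * r * 5 ^ n) - (4 * X + 1) ^ (2 * r * 5 ^ n)

/-- `LC_m` in `(ZMod 5)[Y]`: for `m = 0` the image of `C_{0,n,r}` under `L₂`, and
for `1 ≤ m ≤ n-2` the image of `C_{m,n,r}`. -/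
noncomputable def LC (n r m : ℕ) : Polynomial (ZMod 5) :=
  if m = 0 then
    4 * C (r : ZMod 5) * X ^ (24 * 5 ^ (n - 2)) *
      ((4 * X + 1) ^ ((100 * r - 16) * 5 ^ (n - 2))
        - (4 * X + 1) ^ ((50 * r - 8) * 5 ^ (n - 2)))
  else
    3 * C (r : ZMod 5) * X ^ (6 * 5 ^ (n - 1) - 6 * 5 ^ (n - m - 2)) *
      ((4 * X + 1) ^ (16 * 5 ^ (n - 1) + 4 * 5 ^ (n - m - 2) + 4 * (r - 1) * 5 ^ n)
        - (4 * X + 1) ^ (8 * 5 ^ (n - 1) + 2 * 5 ^ (n - m - 2) + 2 * (r - 1) * 5 ^ n))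

/-- `LD_m` in `(ZMod 5)[Y]`: for `m = 0` the image of `D_{0,n,r}` under `L₂`, and
for `1 ≤ m ≤ n-2` the image of `D_{m,n,r}`. -/
noncomputable def LD (n r m : ℕ) : Polynomial (ZMod 5) :=
  if m = 0 then
    3 * C (r : ZMod 5) * X ^ (27 * 5 ^ (n - 2)) *
      ((4 * X + 1) ^ ((100 * r - 18) * 5 ^ (n - 2))
        + (4 * X + 1) ^ ((50 * r - 9) * 5 ^ (n - 2)))
  else
    C (r : ZMod 5) * X ^ (6 * 5 ^ (n - 1) - 3 * 5 ^ (n - m - 2)) *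
      ((4 * X + 1) ^ (16 * 5 ^ (n - 1) + 2 * 5 ^ (n - m - 2) + 4 * (r - 1) * 5 ^ n)
        + (4 * X + 1) ^ (8 * 5 ^ (n - 1) + 5 ^ (n - m - 2) + 2 * (r - 1) * 5 ^ n))

section TruncatedRing

variable {R : Type*} [CommRing R]

theorem one_sub_pow_five_pow (h5 : (5 : R) = 0) (x : R) (k : ℕ) :
    (1 - x) ^ 5 ^ k = 1 - x ^ 5 ^ k := by
  induction k with
  | zero => simp
  | succ k ih =>
    rw [pow_succ 5 k, pow_mul, ih, pow_mul]
    linear_combination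
      (-x ^ 5 ^ k + 2 * (x ^ 5 ^ k) ^ 2 - 2 * (x ^ 5 ^ k) ^ 3 + (x ^ 5 ^ k) ^ 4) * h5

theorem mul_pow_eq_self {a b : R} (h : a * b = a) (k : ℕ) : a * b ^ k = a := by
  induction k with
  | zero => simp
  | succ k ih => rw [pow_succ, ← mul_assoc, ih, h]

theorem one_sub_pow_of_sq_eq_zero {t : R} (ht : t ^ 2 = 0) (k : ℕ) :
    (1 - t) ^ k = 1 - k * t := by
  induction k with
  | zero => simp
  | succ k ih =>
    rw [pow_succ, ih]
    push_cast
    linear_combination (k : R) * ht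

/-- The contribution of the terms of index `0`, written in `y = Y ^ 5 ^ (n - 2)`. -/
theorem leading_terms_eq (h5 : (5 : R) = 0) {y : R} (hy : y ^ 30 = 0) (c : R) (k : ℕ) :
    3 * c * y ^ 25 +
      (4 * c * y ^ 24 * ((1 - y) ^ (100 * k + 84) - (1 - y) ^ (50 * k + 42)) +
        3 * c * y ^ 27 * ((1 - y) ^ (100 * k + 82) + (1 - y) ^ (50 * k + 41))) =
      c * y ^ 29 := by
  have hV : (1 - y) ^ 25 = 1 - y ^ 25 := one_sub_pow_five_pow h5 y 2
  have hB : y ^ 24 * (1 - y) ^ 25 = y ^ 24 := by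
    rw [hV]
    linear_combination (-y ^ 19) * hy
  have h84 : y ^ 24 * (1 - y) ^ (100 * k + 84) = y ^ 24 * (1 - y) ^ 9 := by
    rw [show 100 * k + 84 = 25 * (4 * k + 3) + 9 by ring, pow_add, pow_mul, ← mul_assoc,
      mul_pow_eq_self hB]
  have h42 : y ^ 24 * (1 - y) ^ (50 * k + 42) = y ^ 24 * (1 - y) ^ 17 := by
    rw [show 50 * k + 42 = 25 * (2 * k + 1) + 17 by ring, pow_add, pow_mul, ← mul_assoc,
      mul_pow_eq_self hB]
  have h82 : y ^ 24 * (1 - y) ^ (100 * k + 82) = y ^ 24 * (1 - y) ^ 7 := by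
    rw [show 100 * k + 82 = 25 * (4 * k + 3) + 7 by ring, pow_add, pow_mul, ← mul_assoc,
      mul_pow_eq_self hB]
  have h41 : y ^ 24 * (1 - y) ^ (50 * k + 41) = y ^ 24 * (1 - y) ^ 16 := by
    rw [show 50 * k + 41 = 25 * (2 * k + 1) + 16 by ring, pow_add, pow_mul, ← mul_assoc,
      mul_pow_eq_self hB]
  have key : 3 * y ^ 25 + 4 * (y ^ 24 * (1 - y) ^ 9 - y ^ 24 * (1 - y) ^ 17) +
      3 * y ^ 3 * (y ^ 24 * (1 - y) ^ 7 + y ^ 24 * (1 - y) ^ 16) = y ^ 29 := by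
    linear_combination
      (7 * y ^ 25 - 80 * y ^ 26 + 478 * y ^ 27 - 1817 * y ^ 28 + 4934 * y ^ 29) * h5 +
      (-50953 + 83213 * y - 110371 * y ^ 2 + 121281 * y ^ 3 - 112115 * y ^ 4 +
        88114 * y ^ 5 - 59072 * y ^ 6 + 33544 * y ^ 7 - 15824 * y ^ 8 + 6004 * y ^ 9 -
        1748 * y ^ 10 + 364 * y ^ 11 - 48 * y ^ 12 + 3 * y ^ 13) * hy
  linear_combination c * key + 4 * c * (h84 - h42) + 3 * c * y ^ 3 * (h82 + h41)

/-- The contribution of the terms of index `m ≥ 1`, written in `z = Y ^ 5 ^ (n - m - 2)`, with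
`a = Y ^ (6 * 5 ^ (n - 1) - 6 * 5 ^ (n - m - 2))` and `b = (1 - Y) ^ 5 ^ (n - 1)`. -/
theorem telescoping_terms_eq (h5 : (5 : R) = 0) {a b z : R} (hab : a * b = a) (c : R)
    (i j k l : ℕ) :
    3 * c * a * (b ^ i * (1 - z) ^ 4 - b ^ j * (1 - z) ^ 2) +
        c * (a * z ^ 3) * (b ^ k * (1 - z) ^ 2 + b ^ l * (1 - z)) =
      c * (a * z ^ 5 - a * z) := by
  have hi := mul_pow_eq_self hab i
  have hj := mul_pow_eq_self hab j
  have hk := mul_pow_eq_self hab k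
  have hl := mul_pow_eq_self hab l
  linear_combination 3 * c * (1 - z) ^ 4 * hi - 3 * c * (1 - z) ^ 2 * hj +
    c * z ^ 3 * (1 - z) ^ 2 * hk + c * z ^ 3 * (1 - z) * hl +
    c * a * (-z + 3 * z ^ 2 - 2 * z ^ 3) * h5

end TruncatedRing

section Quotient

variable {R : Type*} [CommRing R]

theorem map_five_eq_zero (φ : Polynomial (ZMod 5) →+* R) : (5 : R) = 0 := by
  have h : ((5 : ℕ) : Polynomial (ZMod 5)) = 0 := CharP.cast_eq_zero _ 5
  rw [← Nat.cast_ofNat, ← map_natCast φ, h, map_zero]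

theorem map_four_mul_X_add_one (φ : Polynomial (ZMod 5) →+* R) : 4 * φ X + 1 = 1 - φ X := by
  linear_combination φ X * map_five_eq_zero φ

theorem map_Ldelta_add_LC_add_LD_zero (φ : Polynomial (ZMod 5) →+* R) {j r : ℕ} (hr : 1 ≤ r)
    (hX : φ X ^ (6 * 5 ^ (j + 1)) = 0) :
    φ (Ldelta (j + 2) r + (LC (j + 2) r 0 + LD (j + 2) r 0)) =
      r * φ X ^ (6 * 5 ^ (j + 1) - 5 ^ j) := by
  obtain ⟨k, rfl⟩ := Nat.exists_eq_add_of_le' hr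
  have h5 := map_five_eq_zero φ
  have hV := one_sub_pow_five_pow h5 (φ X) j
  have hW := one_sub_pow_five_pow h5 (φ X) (j + 2)
  have hy : (φ X ^ 5 ^ j) ^ 30 = 0 := by
    rw [← hX, ← pow_mul]
    ring_nf
  have ht : (φ X ^ 5 ^ (j + 2)) ^ 2 = 0 := by
    rw [pow_add, pow_mul, ← pow_mul]
    linear_combination (φ X ^ 5 ^ j) ^ 20 * hy
  have hN : 6 * 5 ^ (j + 1) - 5 ^ j = 5 ^ j * 29 := by
    rw [pow_succ]; omega
  have hD : φ (Ldelta (j + 2) (k + 1)) = 3 * ((k + 1 : ℕ) : R) * (φ X ^ 5 ^ j) ^ 25 := by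
    simp only [Ldelta, map_sub, map_pow, map_add, map_mul, map_ofNat, map_one,
      map_four_mul_X_add_one]
    rw [mul_comm (4 * (k + 1)), mul_comm (2 * (k + 1)), pow_mul, pow_mul _ (5 ^ (j + 2)), hW,
      one_sub_pow_of_sq_eq_zero ht, one_sub_pow_of_sq_eq_zero ht, ← pow_mul, pow_add 5 j 2]
    push_cast
    linear_combination (-(k + 1 : R) * φ X ^ (5 ^ j * 5 ^ 2)) * h5
  rw [map_add, map_add, hD, hN, pow_mul, ← leading_terms_eq h5 hy _ k]
  simp only [LC, LD, if_true, map_sub, map_pow, map_add, map_mul, map_ofNat, map_one,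
    map_natCast, map_four_mul_X_add_one]
  rw [show 100 * (k + 1) - 16 = 100 * k + 84 by omega,
    show 50 * (k + 1) - 8 = 50 * k + 42 by omega,
    show 100 * (k + 1) - 18 = 100 * k + 82 by omega,
    show 50 * (k + 1) - 9 = 50 * k + 41 by omega]
  simp only [Nat.add_sub_cancel, mul_comm _ (5 ^ j), pow_mul, hV]

theorem map_LC_add_LD (φ : Polynomial (ZMod 5) →+* R) {j m r : ℕ} (hm : 1 ≤ m)
    (hX : φ X ^ (6 * 5 ^ (j + m + 1)) = 0) :
    φ (LC (j + m + 2) r m + LD (j + m + 2) r m) =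
      r * (φ X ^ (6 * 5 ^ (j + m + 1) - 5 ^ j) - φ X ^ (6 * 5 ^ (j + m + 1) - 5 ^ (j + 1))) := by
  have h5 := map_five_eq_zero φ
  have hV := one_sub_pow_five_pow h5 (φ X) j
  have hs : 25 * 5 ^ j ≤ 5 ^ (j + m + 1) := by
    rw [show 25 * 5 ^ j = 5 ^ (j + 2) by ring]
    exact Nat.pow_le_pow_right (by norm_num) (by omega)
  have hz : ∀ i ≤ 6, φ X ^ (6 * 5 ^ (j + m + 1) - (6 - i) * 5 ^ j) =
      φ X ^ (6 * 5 ^ (j + m + 1) - 6 * 5 ^ j) * (φ X ^ 5 ^ j) ^ i := by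
    intro i hi
    rw [← pow_mul, ← pow_add]
    congr 1
    interval_cases i <;> omega
  have hab : φ X ^ (6 * 5 ^ (j + m + 1) - 6 * 5 ^ j) * (1 - φ X) ^ 5 ^ (j + m + 1) =
      φ X ^ (6 * 5 ^ (j + m + 1) - 6 * 5 ^ j) := by
    have hle : 6 * 5 ^ (j + m + 1) ≤ 6 * 5 ^ (j + m + 1) - 6 * 5 ^ j + 5 ^ (j + m + 1) := by
      omega
    rw [one_sub_pow_five_pow h5, mul_sub, mul_one, ← pow_add, pow_eq_zero_of_le hle hX, sub_zero]
  have hz1 := hz 1 (by norm_num)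
  have hz3 := hz 3 (by norm_num)
  have hz5 := hz 5 (by norm_num)
  norm_num at hz1 hz3 hz5
  rw [show 5 ^ (j + 1) = 5 * 5 ^ j by ring, hz1, hz5,
    ← telescoping_terms_eq h5 hab r (16 + 20 * (r - 1)) (8 + 10 * (r - 1))
      (16 + 20 * (r - 1)) (8 + 10 * (r - 1))]
  simp only [LC, LD, if_neg (Nat.one_le_iff_ne_zero.mp hm), map_sub, map_pow, map_add, map_mul,
    map_ofNat, map_one, map_natCast, map_four_mul_X_add_one]
  rw [show j + m + 2 - 1 = j + m + 1 by omega, show j + m + 2 - m - 2 = j by omega, hz3, ← hV]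
  ring

theorem map_Ldelta_add_sum (φ : Polynomial (ZMod 5) →+* R) {n r u : ℕ} (hr : 1 ≤ r)
    (hu1 : 1 ≤ u) (hu2 : u ≤ n - 1) (hX : φ X ^ (6 * 5 ^ (n - 1)) = 0) :
    φ (Ldelta n r + ∑ m ∈ Finset.range u, (LC n r m + LD n r m)) =
      r * φ X ^ (6 * 5 ^ (n - 1) - 5 ^ (n - u - 1)) := by
  induction u, hu1 using Nat.le_induction with
  | base =>
    obtain ⟨j, rfl⟩ : ∃ j, n = j + 2 := ⟨n - 2, by omega⟩
    rw [Finset.sum_range_one]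
    exact map_Ldelta_add_LC_add_LD_zero φ hr hX
  | succ u hu ih =>
    obtain ⟨j, rfl⟩ : ∃ j, n = j + u + 2 := ⟨n - u - 2, by omega⟩
    rw [Finset.sum_range_succ, ← add_assoc, map_add, ih (by omega), map_LC_add_LD φ hu hX,
      show j + u + 2 - u - 1 = j + 1 by omega, show j + u + 2 - (u + 1) - 1 = j by omega,
      show j + u + 2 - 1 = j + u + 1 by omega]
    ring

end Quotient

/-- Theorem 4.11, first case: for `n ≥ 2`, `r ≥ 1`, and `1 ≤ u ≤ n-1`,
`Y^(5^n + 5^(n-1) - 5^(n-u-1))` divides `LΔ + Σ_{m=0}^{u-1} (LC_m + LD_m)`. -/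
theorem stmt_8 (n r : ℕ) (hn : 2 ≤ n) (hr : 1 ≤ r) (u : ℕ) (hu1 : 1 ≤ u) (hu2 : u ≤ n - 1) :
    (X : Polynomial (ZMod 5)) ^ (5 ^ n + 5 ^ (n - 1) - 5 ^ (n - u - 1)) ∣
      Ldelta n r + ∑ m ∈ Finset.range u, (LC n r m + LD n r m) := by
  have hN : 5 ^ n + 5 ^ (n - 1) = 6 * 5 ^ (n - 1) := by
    obtain ⟨k, rfl⟩ := Nat.exists_eq_add_of_le' hn
    simp only [show k + 2 - 1 = k + 1 by omega]
    ring
  rw [hN]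
  have hX : Ideal.Quotient.mk (Ideal.span {(X : Polynomial (ZMod 5)) ^ (6 * 5 ^ (n - 1))}) X ^
      (6 * 5 ^ (n - 1)) = 0 := by
    rw [← map_pow, Ideal.Quotient.eq_zero_iff_mem]
    exact Ideal.mem_span_singleton_self _
  have h := map_Ldelta_add_sum _ hr hu1 hu2 hX
  rw [← map_pow, ← map_natCast (Ideal.Quotient.mk _), ← map_mul, Ideal.Quotient.eq,
    Ideal.mem_span_singleton] at h
  exact (dvd_sub_left (dvd_mul_left _ _)).mp ((pow_dvd_pow X (Nat.sub_le _ _)).trans h)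
end

section
/- Fix integers r ≥ 2 and n ≥ 1. In the multivariate polynomial ring over ZMod 5 with two indeterminates D and E, define, for k ≥ 2: c_{0,k} = 4·(r : ZMod 5)·D^(42·5^(k−2)+2(r−1)·5^k)·E^(24·5^(k−2)) and d_{0,k} = 3·(r : ZMod 5)·D^(41·5^(k−2)+2(r−1)·5^k)·E^(27·5^(k−2)); and for k ≥ 3 and 1 ≤ m ≤ k−2: c_{m,k} = 3·(r : ZMod 5)·D^(8·5^(k−1)+2·5^(k−m−2)+2(r−1)·5^k)·E^(6·5^(k−1)−6·5^(k−m−2)) and d_{m,k} = (r : ZMod 5)·D^(8·5^(k−1)+5^(k−m−2)+2(r−1)·5^k)·E^(6·5^(k−1)−3·5^(k−m−2)). Set F_1 = D^(10r) and, for k ≥ 2, F_k = D^(2r·5^k) + Σ_{m=0}^{k−2} (c_{m,k} + d_{m,k}). Then F_{n+1} = (F_n)^5 + c_{n−1,n+1} + d_{n−1,n+1}. -/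
open MvPolynomial Finset

/-- The correction term `C_{m,k,r}` mod 5, as a polynomial in `D` (for `Δ`) and
`E` (for `E₄`) over `ZMod 5`. -/
noncomputable def corrC (r m k : ℕ) : MvPolynomial (Fin 2) (ZMod 5) :=
  if m = 0 then
    4 * C (r : ZMod 5) * X 0 ^ (42 * 5 ^ (k - 2) + 2 * (r - 1) * 5 ^ k)
      * X 1 ^ (24 * 5 ^ (k - 2))
  else
    3 * C (r : ZMod 5) * X 0 ^ (8 * 5 ^ (k - 1) + 2 * 5 ^ (k - m - 2) + 2 * (r - 1) * 5 ^ k)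
      * X 1 ^ (6 * 5 ^ (k - 1) - 6 * 5 ^ (k - m - 2))

/-- The correction term `D_{m,k,r}` mod 5, as a polynomial in `D` (for `Δ`) and
`E` (for `E₄`) over `ZMod 5`. -/
noncomputable def corrD (r m k : ℕ) : MvPolynomial (Fin 2) (ZMod 5) :=
  if m = 0 then
    3 * C (r : ZMod 5) * X 0 ^ (41 * 5 ^ (k - 2) + 2 * (r - 1) * 5 ^ k)
      * X 1 ^ (27 * 5 ^ (k - 2))
  else
    C (r : ZMod 5) * X 0 ^ (8 * 5 ^ (k - 1) + 5 ^ (k - m - 2) + 2 * (r - 1) * 5 ^ k)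
      * X 1 ^ (6 * 5 ^ (k - 1) - 3 * 5 ^ (k - m - 2))

/-- The candidate modular form `f_{r·5^k/a_k}` mod 5: `F 1 = D^(10r)` and, for
`k ≥ 2`, `F k = D^(2r·5^k) + Σ_{m=0}^{k-2} (c_{m,k} + d_{m,k})`. -/
noncomputable def modF (r k : ℕ) : MvPolynomial (Fin 2) (ZMod 5) :=
  if k = 1 then X 0 ^ (10 * r)
  else X 0 ^ (2 * r * 5 ^ k) + ∑ m ∈ Finset.range (k - 1), (corrC r m k + corrD r m k)

/-- The Frobenius fixes the coefficients of a monomial over `ZMod 5` and multiplies its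
exponents by `5`. -/
lemma monomial_pow_five (a : ZMod 5) (i j : ℕ) :
    (C a * X 0 ^ i * X 1 ^ j : MvPolynomial (Fin 2) (ZMod 5)) ^ 5
      = C a * X 0 ^ (5 * i) * X 1 ^ (5 * j) := by
  have : Fact (Nat.Prime 5) := ⟨by norm_num⟩
  rw [mul_pow, mul_pow, ← C_pow, ZMod.pow_card, ← pow_mul, ← pow_mul, mul_comm i, mul_comm j]

lemma four_mul_C (a : ZMod 5) : (4 * C a : MvPolynomial (Fin 2) (ZMod 5)) = C (4 * a) := by
  rw [map_mul, map_ofNat]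

lemma three_mul_C (a : ZMod 5) : (3 * C a : MvPolynomial (Fin 2) (ZMod 5)) = C (3 * a) := by
  rw [map_mul, map_ofNat]

lemma corrC_pow_five (r m k : ℕ) (h : m + 2 ≤ k) :
    corrC r m k ^ 5 = corrC r m (k + 1) := by
  obtain ⟨l, rfl⟩ := Nat.exists_eq_add_of_le h
  have e1 : m + 2 + l - 2 = m + l := by omega
  have e2 : m + 2 + l + 1 - 2 = m + l + 1 := by omega
  have e3 : m + 2 + l - 1 = m + l + 1 := by omega
  have e4 : m + 2 + l + 1 - 1 = m + l + 2 := by omega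
  have e5 : m + 2 + l - m - 2 = l := by omega
  have e6 : m + 2 + l + 1 - m - 2 = l + 1 := by omega
  unfold corrC
  split_ifs
  · rw [four_mul_C, monomial_pow_five, e1, e2]
    congr 2
    · congr 1; ring
    · ring
  · rw [three_mul_C, monomial_pow_five, e3, e4, e5, e6, Nat.mul_sub 5]
    congr 3
    · ring
    · ring
    · ring

lemma corrD_pow_five (r m k : ℕ) (h : m + 2 ≤ k) :
    corrD r m k ^ 5 = corrD r m (k + 1) := by
  obtain ⟨l, rfl⟩ := Nat.exists_eq_add_of_le h
  have e1 : m + 2 + l - 2 = m + l := by omega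
  have e2 : m + 2 + l + 1 - 2 = m + l + 1 := by omega
  have e3 : m + 2 + l - 1 = m + l + 1 := by omega
  have e4 : m + 2 + l + 1 - 1 = m + l + 2 := by omega
  have e5 : m + 2 + l - m - 2 = l := by omega
  have e6 : m + 2 + l + 1 - m - 2 = l + 1 := by omega
  unfold corrD
  split_ifs
  · rw [three_mul_C, monomial_pow_five, e1, e2]
    congr 2
    · congr 1; ring
    · ring
  · rw [monomial_pow_five, e3, e4, e5, e6, Nat.mul_sub 5]
    congr 3
    · ring
    · ring
    · ring

/-- Corollary 1.2 mod 5: for `r ≥ 2` and `n ≥ 1`,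
`F_{n+1} = (F_n)^5 + c_{n-1,n+1} + d_{n-1,n+1}`. -/
theorem stmt_12 (r n : ℕ) (hr : 2 ≤ r) (hn : 1 ≤ n) :
    modF r (n + 1) = (modF r n) ^ 5 + corrC r (n - 1) (n + 1) + corrD r (n - 1) (n + 1) := by
  have : Fact (Nat.Prime 5) := ⟨by norm_num⟩
  obtain ⟨n, rfl⟩ := Nat.exists_eq_add_of_le' hn
  rcases Nat.eq_zero_or_pos n with rfl | hn0
  · simp only [modF]
    norm_num
    ring
  · have h1 : n + 1 + 1 ≠ 1 := by omega
    have h2 : n + 1 ≠ 1 := by omega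
    simp only [modF, if_neg h1, if_neg h2, Nat.add_sub_cancel]
    rw [Finset.sum_range_succ, add_pow_char, sum_pow_char, ← pow_mul]
    have hs : ∑ m ∈ Finset.range n, (corrC r m (n + 1) + corrD r m (n + 1)) ^ 5
        = ∑ m ∈ Finset.range n, (corrC r m (n + 1 + 1) + corrD r m (n + 1 + 1)) := by
      refine Finset.sum_congr rfl fun m hm => ?_
      have hm' : m + 2 ≤ n + 1 := by
        have := Finset.mem_range.mp hm
        omega
      rw [add_pow_char, corrC_pow_five r m _ hm', corrD_pow_five r m _ hm']
    rw [hs, mul_assoc (2 * r), ← pow_succ]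
    ring
end

section
/- For all integers n ≥ 0 and r ≥ 1, in the polynomial ring (ZMod 13)[X], the polynomial ((X+12)·(X²+5X+1))^(13^n) divides X^(14·r·13^n)·(X^(14r) − 1)^(13^n). -/
open Polynomial

theorem cubic_dvd_X_pow_fourteen_sub_one :
    ((X + 12) * (X ^ 2 + 5 * X + 1) : Polynomial (ZMod 13)) ∣ X ^ 14 - 1 := by
  have h : (13 : Polynomial (ZMod 13)) = 0 := by
    exact_mod_cast CharP.cast_eq_zero (Polynomial (ZMod 13)) 13
  refine ⟨X ^ 11 + 9 * X ^ 10 + 7 * X ^ 9 + 9 * X ^ 8 + X ^ 7 +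
    X ^ 4 + 9 * X ^ 3 + 7 * X ^ 2 + 9 * X + 1, ?_⟩
  linear_combination
    (-2 * X ^ 13 - 17 * X ^ 12
      - 53 * X ^ 11 - 53 * X ^ 10 - 50 * X ^ 9 - 13 * X ^ 8 - X ^ 7
      - 2 * X ^ 6 - 17 * X ^ 5 - 53 * X ^ 4 - 53 * X ^ 3 - 50 * X ^ 2 - 13 * X - 1) * h

/-- Key divisibility in Theorem 5.5: for `n ≥ 0` and `r ≥ 1`, in `(ZMod 13)[X]`,
`((X+12)(X²+5X+1))^(13^n)` divides `X^(14r·13^n)·(X^(14r) - 1)^(13^n)`. -/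
theorem stmt_17 (n r : ℕ) (hr : 1 ≤ r) :
    ((X + 12) * (X ^ 2 + 5 * X + 1) : Polynomial (ZMod 13)) ^ (13 ^ n) ∣
      X ^ (14 * r * 13 ^ n) * (X ^ (14 * r) - 1) ^ (13 ^ n) := by
  rw [pow_mul X 14 r]
  refine Dvd.dvd.mul_left (pow_dvd_pow_of_dvd ?_ _) _
  exact cubic_dvd_X_pow_fourteen_sub_one.trans (sub_one_dvd_pow_sub_one _ r)
end
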